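/- arXiv:2512.13537 — 6 statements merged into one kernel-verified Lean document; each statement's English description precedes it below -/
import Mathlib

section
/- For every k ≥ 0 the gAEGD iterates satisfy the energy identity r_{k+1}^2 = r_k^2 − (r_{k+1} − r_k)^2 − (2/η) F_k F'_k ‖x_{k+1} − x_k‖^2. -/
/-- Energy identity for the gAEGD iterates:
`r_{k+1}^2 = r_k^2 − (r_{k+1} − r_k)^2 − (2/η) F_k F'_k ‖x_{k+1} − x_k‖^2`. -/
theorem gAEGD_energy_identity
    {d : ℕ} (hd : 1 ≤ d)
    (f : EuclideanSpace ℝ (Fin d) → ℝ) (hf : Differentiable ℝ f)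
    (Fhat : ℝ → ℝ) (hFdiff : Differentiable ℝ Fhat)
    (hFmono : StrictMonoOn Fhat (Set.Ioi (0 : ℝ)))
    (hFpos : ∀ s : ℝ, 0 < s → 0 < Fhat s)
    (hF'pos : ∀ s : ℝ, 0 < s → 0 < deriv Fhat s)
    (c : ℝ) (hc : ∀ y, 0 < f y + c)
    (η : ℝ) (hη : 0 < η)
    (x : ℕ → EuclideanSpace ℝ (Fin d)) (r : ℕ → ℝ)
    (hr0 : 0 < r 0)
    (hrec_r : ∀ k : ℕ, r (k + 1) = r k /
      (1 + η * (deriv Fhat (f (x k) + c) / Fhat (f (x k) + c)) * ‖gradient f (x k)‖ ^ 2))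
    (hrec_x : ∀ k : ℕ, x (k + 1) =
      x k - (η * (r (k + 1) / Fhat (f (x k) + c))) • gradient f (x k)) :
    ∀ k : ℕ, (r (k + 1)) ^ 2 = (r k) ^ 2 - (r (k + 1) - r k) ^ 2
      - (2 / η) * (Fhat (f (x k) + c) * deriv Fhat (f (x k) + c)) * ‖x (k + 1) - x k‖ ^ 2 := by
  intro k
  have hF := hFpos _ (hc (x k))
  have hF' := hF'pos _ (hc (x k))
  have hr := hrec_r k
  have hx : ‖x (k + 1) - x k‖ ^ 2 =
      (η * (r (k + 1) / Fhat (f (x k) + c))) ^ 2 * ‖gradient f (x k)‖ ^ 2 := by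
    rw [hrec_x k, sub_sub_cancel_left, norm_neg, norm_smul, mul_pow, Real.norm_eq_abs, sq_abs]
  rw [hx]
  generalize Fhat (f (x k) + c) = F at *
  generalize deriv Fhat (f (x k) + c) = F' at *
  generalize ‖gradient f (x k)‖ = g at *
  have hpos : 0 < 1 + η * (F' / F) * g ^ 2 := by positivity
  have hr' : r k = r (k + 1) * (1 + η * (F' / F) * g ^ 2) := by
    rw [hr, div_mul_cancel₀ _ hpos.ne']
  rw [hr']
  field_simp
  ring
end

section
/- For every j ≥ 0 the gAEGD iterates satisfy the per-step function-value bound f(x_{j+1}) ≤ f(x_j) + (r_{j+1} − r_j)/F'_j + (L η / (4 F_j F'_j)) (r_j^2 − r_{j+1}^2). -/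
/-- The descent lemma: a function with `L`-Lipschitz gradient lies below its quadratic upper model. -/
theorem descent_of_lipschitz_gradient {E : Type*} [NormedAddCommGroup E] [InnerProductSpace ℝ E]
    [CompleteSpace E] {f : E → ℝ} (hf : Differentiable ℝ f) {L : ℝ}
    (hLip : ∀ y z, ‖gradient f y - gradient f z‖ ≤ L * ‖y - z‖) (x v : E) :
    f (x + v) ≤ f x + inner ℝ (gradient f x) v + L / 2 * ‖v‖ ^ 2 := by
  let g : ℝ → ℝ := fun t =>
    f (x + t • v) - t * inner ℝ (gradient f x) v - L / 2 * ‖v‖ ^ 2 * t ^ 2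
  have hg : ∀ t, HasDerivAt g (inner ℝ (gradient f (x + t • v)) v
      - inner ℝ (gradient f x) v - L * ‖v‖ ^ 2 * t) t := by
    intro t
    have hline : HasDerivAt (fun t : ℝ => x + t • v) v t := by
      simpa using ((hasDerivAt_id t).smul_const v).const_add x
    have hcomp : HasDerivAt (fun t : ℝ => f (x + t • v)) (inner ℝ (gradient f (x + t • v)) v) t := by
      simpa [Function.comp_def] using (hf (x + t • v)).hasGradientAt.hasFDerivAt.comp_hasDerivAt t hline
    have h := (hcomp.sub ((hasDerivAt_id t).mul_const (inner ℝ (gradient f x) v))).sub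
      ((hasDerivAt_pow 2 t).const_mul (L / 2 * ‖v‖ ^ 2))
    refine h.congr_deriv ?_
    norm_num
    ring
  have hanti : AntitoneOn g (Set.Icc 0 1) := by
    refine antitoneOn_of_deriv_nonpos (convex_Icc 0 1)
      (fun t _ => (hg t).continuousAt.continuousWithinAt)
      (fun t _ => (hg t).differentiableAt.differentiableWithinAt) fun t ht => ?_
    rw [interior_Icc] at ht
    rw [(hg t).deriv, ← inner_sub_left]
    have hdiff : ‖gradient f (x + t • v) - gradient f x‖ ≤ L * (t * ‖v‖) := by
      simpa [norm_smul, abs_of_pos ht.1] using hLip (x + t • v) x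
    have hcs := real_inner_le_norm (gradient f (x + t • v) - gradient f x) v
    nlinarith [mul_le_mul_of_nonneg_right hdiff (norm_nonneg v)]
  have h01 := hanti (Set.left_mem_Icc.2 zero_le_one) (Set.right_mem_Icc.2 zero_le_one) zero_le_one
  simp only [g, one_smul, zero_smul, add_zero] at h01
  linarith


/-- Per-step function-value bound:
`f(x_{j+1}) ≤ f(x_j) + (r_{j+1} − r_j)/F'_j + (Lη/(4 F_j F'_j))(r_j^2 − r_{j+1}^2)`. -/
theorem gAEGD_per_step_function_bound
    {d : ℕ} (hd : 1 ≤ d)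
    (f : EuclideanSpace ℝ (Fin d) → ℝ) (hf : Differentiable ℝ f)
    (L : ℝ) (hL : 0 < L)
    (hLip : ∀ y z, ‖gradient f y - gradient f z‖ ≤ L * ‖y - z‖)
    (fstar : ℝ) (hfstar : IsGLB (Set.range f) fstar)
    (Fhat : ℝ → ℝ) (hFdiff : Differentiable ℝ Fhat)
    (hFmono : StrictMonoOn Fhat (Set.Ioi (0 : ℝ)))
    (hFconc : ConcaveOn ℝ (Set.Ioi (0 : ℝ)) Fhat)
    (hFpos : ∀ s : ℝ, 0 < s → 0 < Fhat s)
    (hF'pos : ∀ s : ℝ, 0 < s → 0 < deriv Fhat s)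
    (c : ℝ) (hc : 0 < fstar + c)
    (η : ℝ) (hη : 0 < η)
    (x : ℕ → EuclideanSpace ℝ (Fin d)) (r : ℕ → ℝ)
    (hr0 : 0 < r 0)
    (hrec_r : ∀ k : ℕ, r (k + 1) = r k /
      (1 + η * (deriv Fhat (f (x k) + c) / Fhat (f (x k) + c)) * ‖gradient f (x k)‖ ^ 2))
    (hrec_x : ∀ k : ℕ, x (k + 1) =
      x k - (η * (r (k + 1) / Fhat (f (x k) + c))) • gradient f (x k)) :
    ∀ j : ℕ, f (x (j + 1)) ≤ f (x j)
      + (r (j + 1) - r j) / deriv Fhat (f (x j) + c)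
      + (L * η / (4 * Fhat (f (x j) + c) * deriv Fhat (f (x j) + c)))
          * ((r j) ^ 2 - (r (j + 1)) ^ 2) := by
  have hF : ∀ k, 0 < Fhat (f (x k) + c) ∧ 0 < deriv Fhat (f (x k) + c) := by
    intro k
    have hk : 0 < f (x k) + c := by linarith [hfstar.1 (Set.mem_range_self (x k))]
    exact ⟨hFpos _ hk, hF'pos _ hk⟩
  have hr : ∀ k, 0 < r k := by
    intro k
    induction k with
    | zero => exact hr0
    | succ k ih =>
      obtain ⟨hA, hB⟩ := hF k
      rw [hrec_r]
      positivity
  intro j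
  obtain ⟨hA, hB⟩ := hF j
  have hrj := hrec_r j
  have hdesc := descent_of_lipschitz_gradient hf hLip (x j)
    (-((η * (r (j + 1) / Fhat (f (x j) + c))) • gradient f (x j)))
  rw [← sub_eq_add_neg, ← hrec_x j, inner_neg_right, real_inner_smul_right,
    real_inner_self_eq_norm_sq, norm_neg, norm_smul, mul_pow, Real.norm_eq_abs, sq_abs] at hdesc
  set A := Fhat (f (x j) + c)
  set B := deriv Fhat (f (x j) + c)
  set G := ‖gradient f (x j)‖ ^ 2
  have hG : 0 ≤ G := by positivity
  have hstep : r j = r (j + 1) + r (j + 1) * (η * (B / A) * G) := by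
    rw [eq_div_iff (by positivity)] at hrj
    linarith
  have hlin : (r (j + 1) - r j) / B = -(η * (r (j + 1) / A) * G) := by
    rw [hstep]
    field_simp
    ring
  have hquad : L * η / (4 * A * B) * (r j ^ 2 - r (j + 1) ^ 2)
      = L / 2 * ((η * (r (j + 1) / A)) ^ 2 * G)
        + L * η / (4 * A * B) * (r (j + 1) * (η * (B / A) * G)) ^ 2 := by
    rw [hstep]
    field_simp
    ring
  have hnonneg : 0 ≤ L * η / (4 * A * B) * (r (j + 1) * (η * (B / A) * G)) ^ 2 := by positivity
  rw [hlin, hquad]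
  linarith
end

section
/- Define the energy gap e_k = F_k − r_k and F* = F̂(f* + c). Then for all integers k > m ≥ 0 the gAEGD iterates satisfy e_k ≤ e_m + (L η / (4 F*)) (r_m^2 − r_k^2). -/
/-- The descent lemma: a differentiable function with `L`-Lipschitz gradient lies below its
quadratic upper model. -/
theorem le_add_inner_gradient_add_sq {E : Type*} [NormedAddCommGroup E] [InnerProductSpace ℝ E]
    [CompleteSpace E] {f : E → ℝ} (hf : Differentiable ℝ f) {L : ℝ}
    (hLip : ∀ y z, ‖gradient f y - gradient f z‖ ≤ L * ‖y - z‖) (a v : E) :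
    f (a + v) ≤ f a + inner ℝ (gradient f a) v + L / 2 * ‖v‖ ^ 2 := by
  set φ : ℝ → ℝ := fun t =>
    f (a + t • v) - t * inner ℝ (gradient f a) v - L / 2 * ‖v‖ ^ 2 * t ^ 2
  have hφ (t : ℝ) : HasDerivAt φ
      (inner ℝ (gradient f (a + t • v)) v - inner ℝ (gradient f a) v - L * ‖v‖ ^ 2 * t) t := by
    have hline : HasDerivAt (fun s : ℝ => a + s • v) v t := by
      simpa using ((hasDerivAt_id t).smul_const v).const_add a
    have hcomp : HasDerivAt (fun s : ℝ => f (a + s • v))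
        (inner ℝ (gradient f (a + t • v)) v) t := by
      exact (hf (a + t • v)).hasGradientAt.hasFDerivAt.comp_hasDerivAt t hline
    have hlin : HasDerivAt (fun s : ℝ => s * inner ℝ (gradient f a) v)
        (inner ℝ (gradient f a) v) t := by
      simpa using (hasDerivAt_id t).mul_const (inner ℝ (gradient f a) v)
    have hquad : HasDerivAt (fun s : ℝ => L / 2 * ‖v‖ ^ 2 * s ^ 2) (L * ‖v‖ ^ 2 * t) t := by
      refine ((hasDerivAt_pow 2 t).const_mul (L / 2 * ‖v‖ ^ 2)).congr_deriv ?_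
      norm_num
      ring
    exact (hcomp.sub hlin).sub hquad
  have hanti : AntitoneOn φ (Set.Ici 0) := by
    refine antitoneOn_of_deriv_nonpos (convex_Ici 0)
      (fun t _ => (hφ t).continuousAt.continuousWithinAt)
      (fun t _ => (hφ t).differentiableAt.differentiableWithinAt) fun t ht => ?_
    rw [interior_Ici] at ht
    rw [(hφ t).deriv, ← inner_sub_left, sub_nonpos]
    calc inner ℝ (gradient f (a + t • v) - gradient f a) v
        ≤ ‖gradient f (a + t • v) - gradient f a‖ * ‖v‖ := real_inner_le_norm _ _
      _ ≤ L * ‖a + t • v - a‖ * ‖v‖ := by gcongr; exact hLip _ _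
      _ = L * ‖v‖ ^ 2 * t := by
        rw [add_sub_cancel_left, norm_smul, Real.norm_of_nonneg (le_of_lt ht)]
        ring
  have h := hanti Set.self_mem_Ici (Set.mem_Ici.2 zero_le_one) zero_le_one
  simp only [φ, one_smul, zero_smul, add_zero] at h
  linarith

/-- A differentiable concave function lies below its tangent lines. -/
theorem ConcaveOn.le_add_deriv_mul_sub {S : Set ℝ} {F : ℝ → ℝ} (hF : ConcaveOn ℝ S F) {s t : ℝ}
    (hs : s ∈ S) (ht : t ∈ S) (hd : DifferentiableAt ℝ F s) :
    F t ≤ F s + deriv F s * (t - s) := by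
  rcases lt_trichotomy s t with hst | rfl | hst
  · have h := hF.slope_le_deriv hs ht hst hd
    rw [slope_def_field, div_le_iff₀ (sub_pos.2 hst)] at h
    linarith
  · simp
  · have h := hF.deriv_le_slope ht hs hst hd
    rw [slope_def_field, le_div_iff₀ (sub_pos.2 hst)] at h
    linarith


/-- Gap estimate: with `e_k = F_k − r_k` and `F* = F̂(f* + c)`, for all `k > m ≥ 0`,
`e_k ≤ e_m + (Lη/(4 F*)) (r_m^2 − r_k^2)`. -/
theorem gAEGD_energy_gap_estimate
    {d : ℕ} (hd : 1 ≤ d)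
    (f : EuclideanSpace ℝ (Fin d) → ℝ) (hf : Differentiable ℝ f)
    (L : ℝ) (hL : 0 < L)
    (hLip : ∀ y z, ‖gradient f y - gradient f z‖ ≤ L * ‖y - z‖)
    (fstar : ℝ) (hfstar : IsGLB (Set.range f) fstar)
    (Fhat : ℝ → ℝ) (hFdiff : Differentiable ℝ Fhat)
    (hFmono : StrictMonoOn Fhat (Set.Ioi (0 : ℝ)))
    (hFconc : ConcaveOn ℝ (Set.Ioi (0 : ℝ)) Fhat)
    (hFpos : ∀ s : ℝ, 0 < s → 0 < Fhat s)
    (hF'pos : ∀ s : ℝ, 0 < s → 0 < deriv Fhat s)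
    (c : ℝ) (hc : 0 < fstar + c)
    (η : ℝ) (hη : 0 < η)
    (x : ℕ → EuclideanSpace ℝ (Fin d)) (r : ℕ → ℝ)
    (hr0 : 0 < r 0)
    (hrec_r : ∀ k : ℕ, r (k + 1) = r k /
      (1 + η * (deriv Fhat (f (x k) + c) / Fhat (f (x k) + c)) * ‖gradient f (x k)‖ ^ 2))
    (hrec_x : ∀ k : ℕ, x (k + 1) =
      x k - (η * (r (k + 1) / Fhat (f (x k) + c))) • gradient f (x k)) :
    ∀ m k : ℕ, m < k →
      Fhat (f (x k) + c) - r k ≤ (Fhat (f (x m) + c) - r m)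
        + (L * η / (4 * Fhat (fstar + c))) * ((r m) ^ 2 - (r k) ^ 2) := by
  have hpos (k : ℕ) : 0 < f (x k) + c := by
    linarith [hfstar.1 (Set.mem_range_self (x k))]
  have hF_ge (k : ℕ) : Fhat (fstar + c) ≤ Fhat (f (x k) + c) :=
    hFmono.monotoneOn hc (hpos k) (by linarith [hfstar.1 (Set.mem_range_self (x k))])
  have hFs : 0 < Fhat (fstar + c) := hFpos _ hc
  have hcoef (k : ℕ) :
      0 ≤ η * (deriv Fhat (f (x k) + c) / Fhat (f (x k) + c)) * ‖gradient f (x k)‖ ^ 2 := by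
    have := hFpos _ (hpos k)
    have := hF'pos _ (hpos k)
    positivity
  have hr (k : ℕ) : 0 < r k := by
    induction k with
    | zero => exact hr0
    | succ k ih =>
      rw [hrec_r]
      exact div_pos ih (by linarith [hcoef k])
  have hstep (k : ℕ) : Fhat (f (x (k + 1)) + c) - r (k + 1) ≤ (Fhat (f (x k) + c) - r k)
      + (L * η / (4 * Fhat (fstar + c))) * ((r k) ^ 2 - (r (k + 1)) ^ 2) := by
    have hcoef_k := hcoef k
    have hF := hFpos _ (hpos k)
    have hF' := hF'pos _ (hpos k)
    have hge := hF_ge k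
    have hr1 := hr (k + 1)
    have hrk : r (k + 1) * (1 + η * (deriv Fhat (f (x k) + c) / Fhat (f (x k) + c))
        * ‖gradient f (x k)‖ ^ 2) = r k := by
      rw [hrec_r k]
      exact div_mul_cancel₀ _ (by linarith)
    have htangent := hFconc.le_add_deriv_mul_sub (hpos k) (hpos (k + 1)) (hFdiff _)
    have hdescent := le_add_inner_gradient_add_sq hf hLip (x k)
      (-((η * (r (k + 1) / Fhat (f (x k) + c))) • gradient f (x k)))
    rw [← sub_eq_add_neg, ← hrec_x k, inner_neg_right, real_inner_smul_right,
      real_inner_self_eq_norm_sq, norm_neg, norm_smul, mul_pow, Real.norm_eq_abs, sq_abs]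
      at hdescent
    set A := Fhat (f (x k) + c)
    set D := deriv Fhat (f (x k) + c)
    set G := ‖gradient f (x k)‖ ^ 2
    have hdecr : 0 ≤ r k - r (k + 1) := by
      rw [← hrk]
      nlinarith
    have hmul := mul_le_mul_of_nonneg_left hdescent hF'.le
    have hmodel : D * (-(η * (r (k + 1) / A) * G) + L / 2 * ((η * (r (k + 1) / A)) ^ 2 * G))
        = -(r k - r (k + 1)) + L * η / (2 * A) * (r (k + 1) * (r k - r (k + 1))) := by
      rw [← hrk]
      field_simp
      ring
    have hbound : L * η / (2 * A) * (r (k + 1) * (r k - r (k + 1)))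
        ≤ L * η / (4 * Fhat (fstar + c)) * ((r k) ^ 2 - (r (k + 1)) ^ 2) := by
      calc L * η / (2 * A) * (r (k + 1) * (r k - r (k + 1)))
          ≤ L * η / (2 * Fhat (fstar + c)) * (r (k + 1) * (r k - r (k + 1))) := by gcongr
        _ ≤ L * η / (2 * Fhat (fstar + c)) * (((r k) ^ 2 - (r (k + 1)) ^ 2) / 2) := by
          gcongr
          nlinarith [sq_nonneg (r k - r (k + 1))]
        _ = L * η / (4 * Fhat (fstar + c)) * ((r k) ^ 2 - (r (k + 1)) ^ 2) := by
          field_simp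
          ring
    linarith
  have hanti : Antitone fun k => Fhat (f (x k) + c) - r k
      + L * η / (4 * Fhat (fstar + c)) * (r k) ^ 2 :=
    antitone_nat_of_succ_le fun k => by linarith [hstep k]
  intro m k hmk
  have := hanti hmk.le
  dsimp only at this
  linarith
end

section
/- Set F* = F̂(f* + c) and F̄ = F_0 + L η r_0^2 / (4 F*), where r_0 = F_0 is not required (r_0 > 0 arbitrary) but assume additionally e_0 = F_0 − r_0 so that F̄ = e_0 + r_0 + L η r_0^2/(4F*). Then for every k ≥ 1 the gAEGD iterates satisfy F* ≤ F_k ≤ F̄. -/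
/-- A concave function lies below its tangent lines. -/
theorem ConcaveOn.sub_le_deriv_mul_sub {S : Set ℝ} {φ : ℝ → ℝ} (hφ : ConcaveOn ℝ S φ)
    {s t : ℝ} (hs : s ∈ S) (ht : t ∈ S) (hd : DifferentiableAt ℝ φ s) :
    φ t - φ s ≤ deriv φ s * (t - s) := by
  rcases lt_trichotomy s t with h | rfl | h
  · have key := hφ.slope_le_of_hasDerivAt hs ht h hd.hasDerivAt
    rwa [slope_def_field, div_le_iff₀ (sub_pos.2 h)] at key
  · simp
  · have key := hφ.le_slope_of_hasDerivAt ht hs h hd.hasDerivAt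
    rw [slope_def_field, le_div_iff₀ (sub_pos.2 h)] at key
    linarith

/-- The descent lemma: a function with `L`-Lipschitz gradient is bounded above by its
quadratic model. -/
theorem add_le_of_lipschitz_gradient {E : Type*} [NormedAddCommGroup E]
    [InnerProductSpace ℝ E] [CompleteSpace E] {f : E → ℝ} (hf : Differentiable ℝ f) {L : ℝ}
    (hLip : ∀ y z, ‖gradient f y - gradient f z‖ ≤ L * ‖y - z‖) (y v : E) :
    f (y + v) ≤ f y + inner ℝ (gradient f y) v + L / 2 * ‖v‖ ^ 2 := by
  have hder (t : ℝ) : HasDerivAt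
      (fun t : ℝ => f (y + t • v) - (t * inner ℝ (gradient f y) v + L / 2 * ‖v‖ ^ 2 * t ^ 2))
      (inner ℝ (gradient f (y + t • v)) v
        - (inner ℝ (gradient f y) v + L * ‖v‖ ^ 2 * t)) t := by
    have h1 : HasDerivAt (fun t : ℝ => y + t • v) v t := by
      simpa using ((hasDerivAt_id t).smul_const v).const_add y
    have h2 := (hf (y + t • v)).hasGradientAt.hasFDerivAt.comp_hasDerivAt t h1
    rw [InnerProductSpace.toDual_apply_apply] at h2
    have h3 := ((hasDerivAt_id t).mul_const (inner ℝ (gradient f y) v)).add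
      ((hasDerivAt_pow 2 t).const_mul (L / 2 * ‖v‖ ^ 2))
    refine (h2.sub h3).congr_deriv ?_
    norm_num
    ring
  have hanti := antitoneOn_of_deriv_nonpos (convex_Ici (0 : ℝ))
    (fun t _ => (hder t).continuousAt.continuousWithinAt)
    (fun t _ => (hder t).differentiableAt.differentiableWithinAt)
    (fun t ht => by
      rw [interior_Ici, Set.mem_Ioi] at ht
      rw [(hder t).deriv, ← sub_sub, ← inner_sub_left, sub_nonpos]
      calc inner ℝ (gradient f (y + t • v) - gradient f y) v
          ≤ ‖gradient f (y + t • v) - gradient f y‖ * ‖v‖ := real_inner_le_norm _ _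
        _ ≤ L * ‖y + t • v - y‖ * ‖v‖ := by gcongr; exact hLip _ _
        _ = L * ‖v‖ ^ 2 * t := by
          rw [add_sub_cancel_left, norm_smul, Real.norm_of_nonneg ht.le]; ring)
  have h01 := hanti (Set.mem_Ici.2 le_rfl) (Set.mem_Ici.2 zero_le_one) zero_le_one
  simp only [one_smul, zero_smul, add_zero] at h01
  linarith

/-- The scalar estimate behind one adaptive step: the first-order decrease and the second-order
error are both controlled by the decay `p - q` of the energy, where `q = p / (1 + η (D / A) G)`. -/
theorem energy_step_le {A D G L S p q η : ℝ} (hS : 0 < S) (hSA : S ≤ A) (hD : 0 < D)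
    (hG : 0 ≤ G) (hL : 0 < L) (hη : 0 < η) (hq : 0 ≤ q)
    (hpq : q * (1 + η * (D / A) * G) = p) :
    D * (-(η * (q / A)) * G + L / 2 * ((η * (q / A)) ^ 2 * G))
      ≤ L * η / (4 * S) * (p ^ 2 - q ^ 2) := by
  have hA : 0 < A := hS.trans_le hSA
  have hδ : p - q = η * (q / A) * D * G := by rw [← hpq]; ring
  have hδ0 : 0 ≤ p - q := by rw [hδ]; positivity
  have hwq : q / A ≤ q / S := by gcongr
  calc D * (-(η * (q / A)) * G + L / 2 * ((η * (q / A)) ^ 2 * G))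
      = -(p - q) + L * η / 2 * (q / A) * (p - q) := by rw [hδ]; ring
    _ ≤ L * η / 2 * (q / S) * (p - q) := by
      have : L * η / 2 * (q / A) * (p - q) ≤ L * η / 2 * (q / S) * (p - q) := by gcongr
      linarith
    _ = L * η / (4 * S) * (2 * q * (p - q)) := by field_simp; ring
    _ ≤ L * η / (4 * S) * (p ^ 2 - q ^ 2) := by
      gcongr
      nlinarith [sq_nonneg (p - q)]


/-- Bounds on `F_k`: with `F* = F̂(f* + c)` and `F̄ = F_0 + Lη r_0^2/(4F*)`,
for every `k ≥ 1`, `F* ≤ F_k ≤ F̄`. -/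
theorem gAEGD_Fk_bounds
    {d : ℕ} (hd : 1 ≤ d)
    (f : EuclideanSpace ℝ (Fin d) → ℝ) (hf : Differentiable ℝ f)
    (L : ℝ) (hL : 0 < L)
    (hLip : ∀ y z, ‖gradient f y - gradient f z‖ ≤ L * ‖y - z‖)
    (fstar : ℝ) (hfstar : IsGLB (Set.range f) fstar)
    (Fhat : ℝ → ℝ) (hFdiff : Differentiable ℝ Fhat)
    (hFmono : StrictMonoOn Fhat (Set.Ioi (0 : ℝ)))
    (hFconc : ConcaveOn ℝ (Set.Ioi (0 : ℝ)) Fhat)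
    (hFpos : ∀ s : ℝ, 0 < s → 0 < Fhat s)
    (hF'pos : ∀ s : ℝ, 0 < s → 0 < deriv Fhat s)
    (c : ℝ) (hc : 0 < fstar + c)
    (η : ℝ) (hη : 0 < η)
    (x : ℕ → EuclideanSpace ℝ (Fin d)) (r : ℕ → ℝ)
    (hr0 : 0 < r 0)
    (hrec_r : ∀ k : ℕ, r (k + 1) = r k /
      (1 + η * (deriv Fhat (f (x k) + c) / Fhat (f (x k) + c)) * ‖gradient f (x k)‖ ^ 2))
    (hrec_x : ∀ k : ℕ, x (k + 1) =
      x k - (η * (r (k + 1) / Fhat (f (x k) + c))) • gradient f (x k)) :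
    ∀ k : ℕ, 1 ≤ k →
      Fhat (fstar + c) ≤ Fhat (f (x k) + c) ∧
      Fhat (f (x k) + c) ≤ Fhat (f (x 0) + c) + L * η * (r 0) ^ 2 / (4 * Fhat (fstar + c)) := by
  have hs (y) : fstar ≤ f y := hfstar.1 (Set.mem_range_self y)
  have hpos (y) : 0 < f y + c := by linarith [hs y]
  have hlow (y) : Fhat (fstar + c) ≤ Fhat (f y + c) :=
    hFmono.monotoneOn hc (hpos y) (by linarith [hs y])
  have hS := hFpos _ hc
  have hden (k) : 0 < 1 + η * (deriv Fhat (f (x k) + c) / Fhat (f (x k) + c))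
      * ‖gradient f (x k)‖ ^ 2 := by
    have := hFpos _ (hpos (x k))
    have := hF'pos _ (hpos (x k))
    positivity
  have hr (k) : 0 < r k := by
    induction k with
    | zero => exact hr0
    | succ k ih => rw [hrec_r]; exact div_pos ih (hden k)
  have hanti : Antitone fun k =>
      Fhat (f (x k) + c) + L * η / (4 * Fhat (fstar + c)) * r k ^ 2 := by
    refine antitone_nat_of_succ_le fun k => ?_
    have hD := hF'pos _ (hpos (x k))
    have htan := hFconc.sub_le_deriv_mul_sub (hpos (x k)) (hpos (x (k + 1)))
      (hFdiff (f (x k) + c))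
    have hdesc := add_le_of_lipschitz_gradient hf hLip (x k)
      (-((η * (r (k + 1) / Fhat (f (x k) + c))) • gradient f (x k)))
    rw [← sub_eq_add_neg, ← hrec_x, inner_neg_right, real_inner_smul_right,
      real_inner_self_eq_norm_sq, norm_neg, norm_smul, mul_pow, Real.norm_eq_abs,
      sq_abs] at hdesc
    have hstep := energy_step_le hS (hlow (x k)) hD (sq_nonneg ‖gradient f (x k)‖) hL hη
      (hr (k + 1)).le ((eq_div_iff (hden k).ne').1 (hrec_r k))
    have hmul := mul_le_mul_of_nonneg_left (sub_le_iff_le_add'.2 (hdesc.trans_eq (add_assoc _ _ _)))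
      hD.le
    rw [add_sub_add_right_eq_sub] at htan
    rw [neg_mul] at hstep
    linarith
  intro k _
  refine ⟨hlow _, ?_⟩
  have h0k := hanti (Nat.zero_le k)
  have hnonneg : 0 ≤ L * η / (4 * Fhat (fstar + c)) * r k ^ 2 := by positivity
  rw [mul_div_right_comm]
  simp only at h0k
  linarith
end

section
/- (Two-stage behavior.) Suppose α̲ > 0 is a constant such that F'_k / F_k ≥ α̲ for all k ≥ 0. Let ε > 0, C > 0, and set N_0 = max{ ln(r_0/C) / ln(1 + α̲ η ε), 1 }. Then for every natural number N ≥ N_0, at least one of the following holds: min_{0 ≤ k ≤ N−1} ‖∇f(x_k)‖^2 < ε, or r_N ≤ C. -/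
/-- A real sequence that shrinks by a factor `q ≥ 0` at each of its first `N` steps satisfies
`r N * q ^ N ≤ r 0`. -/
theorem mul_pow_le_of_mul_succ_le {r : ℕ → ℝ} {q : ℝ} (hq : 0 ≤ q) :
    ∀ {N : ℕ}, (∀ k < N, r (k + 1) * q ≤ r k) → r N * q ^ N ≤ r 0
  | 0, _ => by simp
  | n + 1, h => calc
      r (n + 1) * q ^ (n + 1) = r (n + 1) * q * q ^ n := by ring
      _ ≤ r n * q ^ n := mul_le_mul_of_nonneg_right (h n n.lt_succ_self) (pow_nonneg hq n)
      _ ≤ r 0 := mul_pow_le_of_mul_succ_le hq fun k hk => h k (hk.trans n.lt_succ_self)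

/-- Two-stage behavior: if `F'_k/F_k ≥ α̲ > 0` for all `k`, then for every `ε > 0`,
`C > 0`, and every natural `N ≥ N_0 = max{ln(r_0/C)/ln(1 + α̲ η ε), 1}`, either
`min_{0 ≤ k ≤ N−1} ‖∇f(x_k)‖^2 < ε` or `r_N ≤ C`. -/
theorem gAEGD_two_stage_behavior
    {d : ℕ} (hd : 1 ≤ d)
    (f : EuclideanSpace ℝ (Fin d) → ℝ) (hf : Differentiable ℝ f)
    (L : ℝ) (hL : 0 < L)
    (hLip : ∀ y z, ‖gradient f y - gradient f z‖ ≤ L * ‖y - z‖)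
    (fstar : ℝ) (hfstar : IsGLB (Set.range f) fstar)
    (Fhat : ℝ → ℝ) (hFdiff : Differentiable ℝ Fhat)
    (hFmono : StrictMonoOn Fhat (Set.Ioi (0 : ℝ)))
    (hFconc : ConcaveOn ℝ (Set.Ioi (0 : ℝ)) Fhat)
    (hFpos : ∀ s : ℝ, 0 < s → 0 < Fhat s)
    (hF'pos : ∀ s : ℝ, 0 < s → 0 < deriv Fhat s)
    (c : ℝ) (hc : 0 < fstar + c)
    (η : ℝ) (hη : 0 < η)
    (x : ℕ → EuclideanSpace ℝ (Fin d)) (r : ℕ → ℝ)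
    (hr0 : 0 < r 0)
    (hrec_r : ∀ k : ℕ, r (k + 1) = r k /
      (1 + η * (deriv Fhat (f (x k) + c) / Fhat (f (x k) + c)) * ‖gradient f (x k)‖ ^ 2))
    (hrec_x : ∀ k : ℕ, x (k + 1) =
      x k - (η * (r (k + 1) / Fhat (f (x k) + c))) • gradient f (x k))
    (α : ℝ) (hαpos : 0 < α)
    (hαbound : ∀ k : ℕ, α ≤ deriv Fhat (f (x k) + c) / Fhat (f (x k) + c))
    (ε C : ℝ) (hε : 0 < ε) (hC : 0 < C) :
    ∀ N : ℕ,
      max (Real.log (r 0 / C) / Real.log (1 + α * η * ε)) 1 ≤ (N : ℝ) →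
      (∃ k < N, ‖gradient f (x k)‖ ^ 2 < ε) ∨ r N ≤ C := by
  intro N hN
  by_contra! hcon
  obtain ⟨hgrad, hCN⟩ := hcon
  have hq : 1 < 1 + α * η * ε := by linarith [mul_pos (mul_pos hαpos hη) hε]
  have hq0 : 0 < 1 + α * η * ε := by linarith
  have hpos : ∀ k, 0 < r k := by
    intro k
    induction k with
    | zero => exact hr0
    | succ k ih =>
      have := hαpos.le.trans (hαbound k)
      rw [hrec_r]
      positivity
  have hstep : ∀ k < N, r (k + 1) * (1 + α * η * ε) ≤ r k := by
    intro k hk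
    have hle : α * ε ≤ deriv Fhat (f (x k) + c) / Fhat (f (x k) + c) * ‖gradient f (x k)‖ ^ 2 :=
      mul_le_mul (hαbound k) (hgrad k hk) hε.le (hαpos.le.trans (hαbound k))
    have hden := mul_le_mul_of_nonneg_left hle hη.le
    rw [hrec_r, div_mul_eq_mul_div, div_le_iff₀ (by linarith)]
    exact mul_le_mul_of_nonneg_left (by linarith) (hpos k).le
  have hdecay := mul_pow_le_of_mul_succ_le hq0.le hstep
  have hlog : Real.log (r 0 / C) ≤ Real.log ((1 + α * η * ε) ^ N) := by
    rw [Real.log_pow, ← div_le_iff₀ (Real.log_pos hq)]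
    exact (le_max_left _ _).trans hN
  have hpow := (Real.log_le_log_iff (div_pos hr0 hC) (pow_pos hq0 N)).1 hlog
  rw [div_le_iff₀ hC] at hpow
  linarith [mul_lt_mul_of_pos_right hCN (pow_pos hq0 N)]
end

section
/- (Finite termination, KL exponent α ∈ (0,1).) Let (w_k)_{k≥0} be a nonincreasing sequence of nonnegative reals, let α ∈ (0,1) and Q > 0, and suppose that for every k with w_k > 0 one has w_k − w_{k+1} ≥ Q w_k^α. Then w_k = 0 for every k ≥ ⌈ w_0^{1−α} / ((1−α) Q) ⌉; that is, the sequence reaches zero in at most ⌈ w_0^{1−α} / ((1−α) Q) ⌉ steps. -/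
/-- One step of the decrease `u - v ≥ Q u ^ α` lowers the potential `x ^ (1 - α)` by at least
`(1 - α) Q`, by concavity. -/
theorem rpow_one_sub_le_sub_of_mul_rpow_le_sub {u v α Q : ℝ} (hu : 0 < u) (hv : 0 ≤ v)
    (hα₀ : 0 ≤ α) (hα₁ : α ≤ 1) (h : Q * u ^ α ≤ u - v) :
    v ^ (1 - α) ≤ u ^ (1 - α) - (1 - α) * Q := by
  have hconc : (v / u) ^ (1 - α) ≤ 1 + (1 - α) * (v / u - 1) := by
    have := rpow_one_add_le_one_add_mul_self (s := v / u - 1)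
      (by linarith [div_nonneg hv hu.le]) (sub_nonneg.2 hα₁) (by linarith)
    rwa [add_sub_cancel] at this
  have hpow : 0 < u ^ α := Real.rpow_pos_of_pos hu α
  have hsplit : u ^ (1 - α) = u / u ^ α := by rw [Real.rpow_sub hu, Real.rpow_one]
  have hQ : Q ≤ u ^ (1 - α) * (1 - v / u) := by
    have : u ^ (1 - α) * (1 - v / u) = (u - v) / u ^ α := by
      rw [hsplit]
      field_simp
    rwa [this, le_div_iff₀ hpow]
  have hu' : 0 < u ^ (1 - α) := Real.rpow_pos_of_pos hu _
  rw [Real.div_rpow hv hu.le, div_le_iff₀ hu'] at hconc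
  linarith [mul_le_mul_of_nonneg_left hQ (sub_nonneg.2 hα₁)]

/-- Finite termination for KL exponent `α ∈ (0,1)`: a nonincreasing nonnegative
sequence with `w_k − w_{k+1} ≥ Q w_k^α` whenever `w_k > 0` reaches zero in at most
`⌈w_0^{1−α}/((1−α)Q)⌉` steps. -/
theorem KL_finite_termination
    (w : ℕ → ℝ)
    (hmono : ∀ m n : ℕ, m ≤ n → w n ≤ w m)
    (hnonneg : ∀ k : ℕ, 0 ≤ w k)
    (α : ℝ) (hα : α ∈ Set.Ioo (0 : ℝ) 1)
    (Q : ℝ) (hQ : 0 < Q)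
    (hdec : ∀ k : ℕ, 0 < w k → Q * (w k) ^ α ≤ w k - w (k + 1)) :
    ∀ k : ℕ, ⌈(w 0) ^ (1 - α) / ((1 - α) * Q)⌉₊ ≤ k → w k = 0 := by
  obtain ⟨hα₀, hα₁⟩ := hα
  have hβQ : 0 < (1 - α) * Q := mul_pos (sub_pos.2 hα₁) hQ
  have hpotential : ∀ k : ℕ, 0 < w k →
      (w k) ^ (1 - α) ≤ (w 0) ^ (1 - α) - k * ((1 - α) * Q) := by
    intro k
    induction k with
    | zero => simp
    | succ k ih =>
      intro hk
      have hk' : 0 < w k := hk.trans_le (hmono k (k + 1) k.le_succ)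
      have hstep := rpow_one_sub_le_sub_of_mul_rpow_le_sub hk' hk.le hα₀.le hα₁.le (hdec k hk')
      push_cast
      linarith [ih hk']
  intro k hk
  by_contra hne
  have hpos : 0 < w k := (hnonneg k).lt_of_ne' hne
  have hle := (div_le_iff₀ hβQ).1 (Nat.ceil_le.1 hk)
  linarith [hpotential k hpos, Real.rpow_pos_of_pos hpos (1 - α)]
end
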